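/- Let 𝒜 be an elliptic homogeneous constant-coefficient differential operator of order k on ℝ^n. Then ⋂_{ξ ∈ 𝕊^{n−1}} im 𝒜[ξ] = { w ∈ W : 𝒜u = δ_0 w for some u ∈ BV^𝒜_loc(ℝ^n) }, where δ_0 is the Dirac mass at the origin and the equation is understood in the sense of distributions. -/

import Mathlib

open MeasureTheory Metric Filter
open scoped ENNReal RealInnerProductSpace Topology

noncomputable section

/-- Euclidean space `ℝ^n`. -/
abbrev Euc (n : ℕ) : Type := EuclideanSpace ℝ (Fin n)

/-- The `i`-th standard basis vector of `ℝ^n`. -/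
def stdVec (n : ℕ) (i : Fin n) : Euc n := EuclideanSpace.single i (1 : ℝ)

/-- Coefficients `A_I : V →ₗ W` (indexed by `I : Fin k → Fin n`) of a homogeneous linear
constant-coefficient differential operator `𝒜 u = ∑_I A_I ∂_I u` of order `k` on `ℝ^n`. -/
abbrev CoeffOp (n k : ℕ) (V W : Type*) [NormedAddCommGroup V] [InnerProductSpace ℝ V]
    [NormedAddCommGroup W] [InnerProductSpace ℝ W] : Type _ :=
  (Fin k → Fin n) → (V →ₗ[ℝ] W)

variable {V W F : Type*}
  [NormedAddCommGroup V] [InnerProductSpace ℝ V] [FiniteDimensional ℝ V]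
  [NormedAddCommGroup W] [InnerProductSpace ℝ W] [FiniteDimensional ℝ W]

/-- The coefficients represent a linear map on symmetric tensors `V ⊙^k ℝ^n`. -/
def IsSymmetricOp (n k : ℕ) (A : CoeffOp n k V W) : Prop :=
  ∀ (I : Fin k → Fin n) (σ : Equiv.Perm (Fin k)), A (I ∘ σ) = A I

/-- The symbol `𝒜[ξ] v = A (v ⊗^k ξ) = ∑_I (∏ i, ξ_{I i}) A_I v`. -/
def symbolMap (n k : ℕ) (A : CoeffOp n k V W) (ξ : Euc n) : V →ₗ[ℝ] W :=
  ∑ I : Fin k → Fin n, (∏ i, ξ (I i)) • A I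

/-- Ellipticity: the symbol is injective for all `ξ ≠ 0`. -/
def IsElliptic (n k : ℕ) (A : CoeffOp n k V W) : Prop :=
  ∀ ξ : Euc n, ξ ≠ 0 → Function.Injective (symbolMap n k A ξ)

/-- Van Schaftingen's cancellation condition: `⋂_{ξ ∈ 𝕊^{n-1}} im 𝒜[ξ] = {0}`. -/
def IsCanceling (n k : ℕ) (A : CoeffOp n k V W) : Prop :=
  (⋂ ξ ∈ sphere (0 : Euc n) 1, (LinearMap.range (symbolMap n k A ξ) : Set W)) = {0}

/-- Inverse of an endomorphism (junk value when not invertible), via matrix inversion. -/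
def linInv (f : V →ₗ[ℝ] V) : V →ₗ[ℝ] V :=
  letI b := Module.finBasis ℝ V
  Matrix.toLin b b ((LinearMap.toMatrix b b f)⁻¹)

/-- `𝒜†[ξ] = (𝒜*[ξ] 𝒜[ξ])⁻¹ 𝒜*[ξ]`. -/
def Adagger (n k : ℕ) (A : CoeffOp n k V W) (ξ : Euc n) : W →ₗ[ℝ] V :=
  linInv (LinearMap.adjoint (symbolMap n k A ξ) ∘ₗ symbolMap n k A ξ) ∘ₗ
    LinearMap.adjoint (symbolMap n k A ξ)

/-- Condition (WC): for every `w ∈ ⋂_{ξ ∈ 𝕊^{n-1}} im 𝒜[ξ]`,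
`∫_{𝕊^{n-1}} 𝒜†[ξ] w ⊗^{k-n} ξ dℋ^{n-1}(ξ) = 0`, written componentwise in the
tensor coordinates indexed by `J : Fin (k-n) → Fin n`. -/
def IsWeaklyCanceling (n k : ℕ) (A : CoeffOp n k V W) : Prop :=
  ∀ w : W, (∀ ξ ∈ sphere (0 : Euc n) 1, w ∈ LinearMap.range (symbolMap n k A ξ)) →
    ∀ J : Fin (k - n) → Fin n,
      (∫ ξ in sphere (0 : Euc n) 1,
        (∏ i, ξ (J i)) • (Adagger n k A ξ w) ∂(μH[(n : ℝ) - 1])) = 0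

section TestFun

variable [NormedAddCommGroup F] [NormedSpace ℝ F]

/-- Compactly supported smooth test function. -/
def IsTestFun (n : ℕ) (φ : Euc n → F) : Prop :=
  ContDiff ℝ (⊤ : ℕ∞) φ ∧ HasCompactSupport φ

/-- Iterated directional derivative `∂_{I 0} ⋯ ∂_{I (m-1)} φ (x)`. -/
def dirDeriv (n m : ℕ) (I : Fin m → Fin n) (φ : Euc n → F) (x : Euc n) : F :=
  iteratedFDeriv ℝ m φ x (fun i => stdVec n (I i))

/-- Smooth functions of degree-`≤ j` polynomial type. -/
def IsPolyDeg (n : ℕ) (j : ℕ) (P : Euc n → F) : Prop :=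
  ContDiff ℝ (⊤ : ℕ∞) P ∧ ∀ x, iteratedFDeriv ℝ (j + 1) P x = 0

end TestFun

/-- Pointwise application of the operator `𝒜` to a smooth map. -/
def Aapply (n k : ℕ) (A : CoeffOp n k V W) (u : Euc n → V) (x : Euc n) : W :=
  ∑ I : Fin k → Fin n, A I (dirDeriv n k I u x)

/-- `𝒜 u = f σ` (a `W`-valued measure with total-variation measure `σ` and polar density `f`)
in the sense of distributions. -/
def HasDistribA (n k : ℕ) (A : CoeffOp n k V W) (u : Euc n → V) (σ : Measure (Euc n))
    (f : Euc n → W) : Prop :=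
  ∀ φ : Euc n → W, IsTestFun n φ →
    ((-1 : ℝ) ^ k) * (∑ I : Fin k → Fin n,
        ∫ x, ⟪u x, LinearMap.adjoint (A I) (dirDeriv n k I φ x)⟫) =
      ∫ x, ⟪f x, φ x⟫ ∂σ

/-- `u ∈ BV^𝒜_loc(ℝ^n)`: `u` is locally integrable and `𝒜 u` is a `W`-valued Radon measure,
given by its polar decomposition `f σ` with `σ` locally finite and `‖f‖ = 1` σ-a.e. -/
def MemBVAloc (n k : ℕ) (A : CoeffOp n k V W) (u : Euc n → V) : Prop :=
  LocallyIntegrable u volume ∧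
    ∃ (σ : Measure (Euc n)) (f : Euc n → W), IsLocallyFiniteMeasure σ ∧
      LocallyIntegrable f σ ∧ (∀ᵐ x ∂σ, ‖f x‖ = 1) ∧ HasDistribA n k A u σ f

/-- `v` is the family of weak derivatives of order `m` of `u` (componentwise, indexed by
`I : Fin m → Fin n`). -/
def IsWeakDerivFamily (n m : ℕ) (u : Euc n → V) (v : (Fin m → Fin n) → Euc n → V) : Prop :=
  (∀ I, LocallyIntegrable (v I) volume) ∧
    ∀ (I : Fin m → Fin n) (φ : Euc n → ℝ), IsTestFun n φ →
      ∫ x, (dirDeriv n m I φ x) • u x = ((-1 : ℝ) ^ m) • ∫ x, φ x • v I x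

/-- `Q r = o(r^a)` as `r ↓ 0`. -/
def SmallO (Q : ℝ → ℝ≥0∞) (a : ℝ) : Prop :=
  Tendsto (fun r => Q r / ENNReal.ofReal (r ^ a)) (𝓝[>] (0 : ℝ)) (𝓝 0)

section Spaces

variable [NormedAddCommGroup F] [NormedSpace ℝ F]

/-- `f ∈ t^{j,p}(x)`: there is a polynomial `P` of degree at most `j` with
`(⨍_{B_r(x)} |f - P|^p)^{1/p} = o(r^j)` as `r ↓ 0`. -/
def MemT (n : ℕ) (j : ℕ) (p : ℝ) (f : Euc n → F) (x : Euc n) : Prop :=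
  ∃ P : Euc n → F, IsPolyDeg n j P ∧
    SmallO (fun r => ((volume (ball x r))⁻¹ *
      ∫⁻ y in ball x r, (‖f y - P y‖₊ : ℝ≥0∞) ^ p) ^ (1 / p)) (j : ℝ)

/-- `f ∈ t^{j,∞}(x)`: there is a polynomial `P` of degree at most `j` with
`‖f - P‖_{L^∞(B_r(x))} = o(r^j)` as `r ↓ 0`. -/
def MemTInf (n : ℕ) (j : ℕ) (f : Euc n → F) (x : Euc n) : Prop :=
  ∃ P : Euc n → F, IsPolyDeg n j P ∧
    SmallO (fun r => essSup (fun y => (‖f y - P y‖₊ : ℝ≥0∞))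
      (volume.restrict (ball x r))) (j : ℝ)

/-- The Lorentz `L^{p,q}` quasi-norm (for `p, q < ∞`). -/
def lorentzNorm {α : Type*} [MeasurableSpace α] (p q : ℝ) (μ : Measure α) (f : α → F) : ℝ≥0∞ :=
  ENNReal.ofReal p ^ (1 / q) *
    (∫⁻ t in Set.Ioi (0 : ℝ),
      (ENNReal.ofReal t * (μ {x | t < ‖f x‖}) ^ (1 / p)) ^ q * (ENNReal.ofReal t)⁻¹) ^ (1 / q)

/-- `f` is `L^{p,q}`-differentiable of order `j` at `x`:
`‖f - P‖_{L^{p,q}(B_r(x))} = o(r^{j + n/p})` for a polynomial `P` of degree at most `j`. -/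
def MemTLorentz (n : ℕ) (j : ℕ) (p q : ℝ) (f : Euc n → F) (x : Euc n) : Prop :=
  ∃ P : Euc n → F, IsPolyDeg n j P ∧
    SmallO (fun r => lorentzNorm p q (volume.restrict (ball x r)) (fun y => f y - P y))
      ((j : ℝ) + n / p)

/-- `f ∈ L^p_loc`. -/
def LocLp (n : ℕ) (p : ℝ) (f : Euc n → F) : Prop :=
  ∀ K : Set (Euc n), IsCompact K → ∫⁻ x in K, (‖f x‖₊ : ℝ≥0∞) ^ p < ⊤

end Spaces

end

/-- `𝒜 u = δ₀ w` in the sense of distributions. -/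
def HasDistribADirac (n k : ℕ) {V W : Type*}
    [NormedAddCommGroup V] [InnerProductSpace ℝ V] [FiniteDimensional ℝ V]
    [NormedAddCommGroup W] [InnerProductSpace ℝ W] [FiniteDimensional ℝ W]
    (A : CoeffOp n k V W) (u : Euc n → V) (w : W) : Prop :=
  ∀ φ : Euc n → W, IsTestFun n φ →
    ((-1 : ℝ) ^ k) * (∑ I : Fin k → Fin n,
        ∫ x, ⟪u x, LinearMap.adjoint (A I) (dirDeriv n k I φ x)⟫) = ⟪w, φ 0⟫

/-- The symbol of `A` in orthonormal coordinates, as a matrix of polynomials. -/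
noncomputable def symbolMatrix (n k : ℕ) {V W : Type*}
    [NormedAddCommGroup V] [InnerProductSpace ℝ V] [FiniteDimensional ℝ V]
    [NormedAddCommGroup W] [InnerProductSpace ℝ W] [FiniteDimensional ℝ W]
    (A : CoeffOp n k V W) :
    Matrix (Fin (Module.finrank ℝ W)) (Fin (Module.finrank ℝ V)) (MvPolynomial (Fin n) ℝ) :=
  Matrix.of fun c a => ∑ I : Fin k → Fin n,
    MvPolynomial.C ⟪stdOrthonormalBasis ℝ W c, A I (stdOrthonormalBasis ℝ V a)⟫ *
      ∏ i, MvPolynomial.X (I i)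

section Symbol

variable {n k : ℕ} {V W : Type*}
    [NormedAddCommGroup V] [InnerProductSpace ℝ V] [FiniteDimensional ℝ V]
    [NormedAddCommGroup W] [InnerProductSpace ℝ W] [FiniteDimensional ℝ W]

lemma eval_symbolMatrix (A : CoeffOp n k V W) (ξ : Euc n) (c : Fin (Module.finrank ℝ W))
    (a : Fin (Module.finrank ℝ V)) :
    MvPolynomial.eval ξ (symbolMatrix n k A c a) =
      ⟪stdOrthonormalBasis ℝ W c, symbolMap n k A ξ (stdOrthonormalBasis ℝ V a)⟫ := by
  simp [symbolMatrix, symbolMap, inner_sum, inner_smul_right, mul_comm]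

omit [FiniteDimensional ℝ V] [FiniteDimensional ℝ W] in
lemma symbolMap_smul (A : CoeffOp n k V W) (t : ℝ) (ξ : Euc n) :
    symbolMap n k A (t • ξ) = t ^ k • symbolMap n k A ξ := by
  simp [symbolMap, Finset.prod_mul_distrib, Finset.smul_sum, mul_smul]

lemma symbolMap_repr (A : CoeffOp n k V W) (ξ : Euc n) (v : V) (c : Fin (Module.finrank ℝ W)) :
    ⟪stdOrthonormalBasis ℝ W c, symbolMap n k A ξ v⟫ =
      ((symbolMatrix n k A).map (MvPolynomial.eval ξ)).mulVec
        (fun a => ⟪stdOrthonormalBasis ℝ V a, v⟫) c := by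
  conv_lhs => rw [← (stdOrthonormalBasis ℝ V).sum_repr' v]
  simp [Matrix.mulVec, dotProduct, eval_symbolMatrix, inner_sum, inner_smul_right, mul_comm]

/-- An elliptic symbol has a polynomial left inverse up to a scalar polynomial without
nonzero real roots. -/
lemma exists_polynomial_leftInverse {A : CoeffOp n k V W} (hell : IsElliptic n k A) :
    ∃ (q : MvPolynomial (Fin n) ℝ)
      (G : Matrix (Fin (Module.finrank ℝ V)) (Fin (Module.finrank ℝ W))
        (MvPolynomial (Fin n) ℝ)),
      G * symbolMatrix n k A = q • (1 : Matrix _ _ (MvPolynomial (Fin n) ℝ)) ∧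
        ∀ ξ : Euc n, ξ ≠ 0 → MvPolynomial.eval ξ q ≠ 0 := by
  set S := symbolMatrix n k A with hS
  refine ⟨(S.transpose * S).det, (S.transpose * S).adjugate * S.transpose, ?_, fun ξ hξ => ?_⟩
  · rw [Matrix.mul_assoc, Matrix.adjugate_mul]
  · rw [RingHom.map_det, RingHom.mapMatrix_apply, Matrix.map_mul, Matrix.transpose_map]
    set B := S.map (MvPolynomial.eval (ξ : Fin n → ℝ)) with hB
    intro hdet
    obtain ⟨x, hx0, hx⟩ := Matrix.exists_mulVec_eq_zero_iff.2 hdet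
    have hBx : B.mulVec x = 0 := by
      have h1 : (B.mulVec x) ⬝ᵥ (B.mulVec x) = 0 := by
        rw [Matrix.dotProduct_mulVec, Matrix.vecMul_mulVec,
          ← Matrix.dotProduct_mulVec, hx]
        simp
      exact dotProduct_self_eq_zero.1 h1
    apply hx0
    set v : V := ∑ a, x a • stdOrthonormalBasis ℝ V a with hv
    have hxv : (fun a => ⟪stdOrthonormalBasis ℝ V a, v⟫) = x := by
      ext a
      simp [hv, inner_sum, inner_smul_right, OrthonormalBasis.inner_eq_ite]
    have hz : symbolMap n k A ξ v = 0 := by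
      rw [← (stdOrthonormalBasis ℝ W).sum_repr' (symbolMap n k A ξ v)]
      refine Finset.sum_eq_zero fun c _ => ?_
      rw [symbolMap_repr, hxv, ← hS, ← hB, hBx, Pi.zero_apply, zero_smul]
    have : v = 0 := hell ξ hξ (by simpa using hz)
    rw [← hxv, this]
    ext a
    simp

end Symbol


section DiffOp

/-- An algebra morphism out of a polynomial ring attached to commuting endomorphisms. -/
lemma exists_aeval_of_commute {R M ι : Type*} [CommRing R] [AddCommGroup M] [Module R M]
    (f : ι → Module.End R M) (h : ∀ i j, f i * f j = f j * f i) :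
    ∃ Φ : MvPolynomial ι R →ₐ[R] Module.End R M, ∀ i, Φ (MvPolynomial.X i) = f i := by
  have : IsMulCommutative (Algebra.adjoin R (Set.range f)) :=
    Algebra.isMulCommutative_adjoin R (by rintro _ ⟨i, rfl⟩ _ ⟨j, rfl⟩; exact h i j)
  open scoped IsMulCommutative in
  exact ⟨(Algebra.adjoin R (Set.range f)).val.comp
    (MvPolynomial.aeval fun i => ⟨f i, Algebra.subset_adjoin ⟨i, rfl⟩⟩), fun i => by simp⟩

lemma IsTestFun.fderiv_apply {n : ℕ} {F : Type*} [NormedAddCommGroup F] [NormedSpace ℝ F]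
    {φ : Euc n → F} (hφ : IsTestFun n φ) (v : Euc n) : IsTestFun n (fun x => fderiv ℝ φ x v) :=
  ⟨(hφ.1.fderiv_right (m := (⊤ : ℕ∞)) le_rfl).clm_apply contDiff_const,
    hφ.2.fderiv_apply ℝ v⟩

lemma dirDeriv_zero {n : ℕ} {F : Type*} [NormedAddCommGroup F] [NormedSpace ℝ F]
    (I : Fin 0 → Fin n) (φ : Euc n → F) : dirDeriv n 0 I φ = φ := by
  ext x
  simp [dirDeriv]

lemma dirDeriv_succ {n m : ℕ} {F : Type*} [NormedAddCommGroup F] [NormedSpace ℝ F]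
    {φ : Euc n → F} (hφ : ContDiff ℝ (⊤ : ℕ∞) φ) (I : Fin (m + 1) → Fin n) (x : Euc n) :
    dirDeriv n (m + 1) I φ x =
      fderiv ℝ (dirDeriv n m (Fin.tail I) φ) x (stdVec n (I 0)) := by
  have hd : DifferentiableAt ℝ (iteratedFDeriv ℝ m φ) x :=
    (hφ.differentiable_iteratedFDeriv (m := m) (by exact_mod_cast WithTop.coe_lt_top _)) x
  unfold dirDeriv
  rw [iteratedFDeriv_succ_apply_left, fderiv_continuousMultilinear_apply_const_apply hd]
  rfl

lemma IsTestFun.dirDeriv {n : ℕ} {F : Type*} [NormedAddCommGroup F] [NormedSpace ℝ F]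
    {φ : Euc n → F} (hφ : IsTestFun n φ) {m : ℕ} (I : Fin m → Fin n) :
    IsTestFun n (dirDeriv n m I φ) := by
  induction m with
  | zero => rwa [dirDeriv_zero]
  | succ m ih =>
    rw [show _root_.dirDeriv n (m + 1) I φ = _ from funext (dirDeriv_succ hφ.1 I)]
    exact (ih (Fin.tail I)).fderiv_apply _

/-- The space of real-valued test functions. -/
def testSpace (n : ℕ) : Submodule ℝ (Euc n → ℝ) where
  carrier := {f | IsTestFun n f}
  add_mem' hf hg := ⟨hf.1.add hg.1, hf.2.add hg.2⟩
  zero_mem' := ⟨contDiff_const, HasCompactSupport.zero⟩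
  smul_mem' c _ hf := ⟨contDiff_const.smul hf.1, hf.2.smul_left (f := fun _ => c)⟩

/-- Partial derivatives, acting on test functions. -/
noncomputable def partialDeriv {n : ℕ} (i : Fin n) : Module.End ℝ (testSpace n) where
  toFun f := ⟨fun x => fderiv ℝ f.1 x (stdVec n i), f.2.fderiv_apply _⟩
  map_add' f g := by
    ext x
    have hf := f.2.1.differentiable (by simp) x
    have hg := g.2.1.differentiable (by simp) x
    simp [fderiv_add hf hg]
  map_smul' c f := by
    ext x
    have hf := f.2.1.differentiable (by simp) x
    simp [fderiv_const_smul hf]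

lemma partialDeriv_comm {n : ℕ} (i j : Fin n) :
    partialDeriv i * partialDeriv j = partialDeriv j * partialDeriv (n := n) i := by
  ext f x
  have hsymm : IsSymmSndFDerivAt ℝ f.1 x :=
    f.2.1.contDiffAt.isSymmSndFDerivAt (by
      rw [minSmoothness_of_isRCLikeNormedField]
      exact WithTop.coe_le_coe.2 (le_top : (2 : ℕ∞) ≤ ⊤))
  have hd : DifferentiableAt ℝ (fderiv ℝ f.1) x :=
    (f.2.1.fderiv_right (m := (⊤ : ℕ∞)) le_rfl).differentiable (by simp) x
  have key : ∀ i j : Fin n, ((partialDeriv i * partialDeriv j) f).1 x =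
      fderiv ℝ (fderiv ℝ f.1) x (stdVec n i) (stdVec n j) := by
    intro i j
    change fderiv ℝ (fun y => fderiv ℝ f.1 y (stdVec n j)) x (stdVec n i) = _
    rw [fderiv_clm_apply hd (by fun_prop)]
    simp
  exact (key i j).trans ((hsymm _ _).trans (key j i).symm)

lemma exists_constCoeff (n : ℕ) :
    ∃ Φ : MvPolynomial (Fin n) ℝ →ₐ[ℝ] Module.End ℝ (testSpace n),
      ∀ i, Φ (MvPolynomial.X i) = partialDeriv i :=
  exists_aeval_of_commute _ partialDeriv_comm

lemma dirDeriv_sum_smul {n k : ℕ} {F ι : Type*} [NormedAddCommGroup F] [NormedSpace ℝ F]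
    [Fintype ι] {Φ : MvPolynomial (Fin n) ℝ →ₐ[ℝ] Module.End ℝ (testSpace n)}
    (hΦ : ∀ i, Φ (MvPolynomial.X i) = partialDeriv i) (f : ι → testSpace n) (e : ι → F)
    (I : Fin k → Fin n) :
    dirDeriv n k I (fun x => ∑ c, (f c).1 x • e c) =
      fun x => ∑ c, (Φ (∏ i, MvPolynomial.X (I i)) (f c)).1 x • e c := by
  have hsm : ∀ g : ι → testSpace n, ContDiff ℝ (⊤ : ℕ∞) (fun x => ∑ c, (g c).1 x • e c) :=
    fun g => ContDiff.sum fun c _ => (g c).2.1.smul contDiff_const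
  induction k with
  | zero => simp [dirDeriv_zero]
  | succ k ih =>
    ext x
    rw [dirDeriv_succ (hsm f), ih, fderiv_fun_sum]
    · rw [_root_.sum_apply]
      refine Finset.sum_congr rfl fun c _ => ?_
      rw [fderiv_smul_const ((Subtype.prop (Φ _ (f c))).1.differentiable (by simp) x),
        Fin.prod_univ_succ, map_mul, hΦ]
      rfl
    · intro c _
      exact (((Subtype.prop (Φ _ (f c))).1.smul contDiff_const).differentiable (by simp)) x

lemma constCoeff_exp {n : ℕ} {Φ : MvPolynomial (Fin n) ℝ →ₐ[ℝ] Module.End ℝ (testSpace n)}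
    (hΦ : ∀ i, Φ (MvPolynomial.X i) = partialDeriv i) (p : MvPolynomial (Fin n) ℝ) (ξ : Euc n)
    {f : testSpace n} (hf : f.1 =ᶠ[𝓝 0] fun x => Real.exp ⟪x, ξ⟫) :
    (Φ p f).1 =ᶠ[𝓝 0] fun x => MvPolynomial.eval ξ p * Real.exp ⟪x, ξ⟫ := by
  induction p using MvPolynomial.induction_on with
  | C a =>
    rw [MvPolynomial.C_eq_algebraMap]
    simp only [AlgHom.commutes]
    filter_upwards [hf] with x hx
    simp [Module.algebraMap_end_apply, hx]
  | add p q hp hq =>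
    filter_upwards [hp, hq] with x hx hy
    simp [hx, hy, add_mul]
  | mul_X p i hp =>
    rw [mul_comm, map_mul, hΦ]
    filter_upwards [hp.eventuallyEq_nhds] with x hx
    change fderiv ℝ (Φ p f).1 x (stdVec n i) = _
    rw [hx.fderiv_eq]
    have h : HasFDerivAt (fun x : Euc n => MvPolynomial.eval ξ p * Real.exp ⟪x, ξ⟫)
        (MvPolynomial.eval ξ p • Real.exp ⟪x, ξ⟫ • (innerSL ℝ ξ : Euc n →L[ℝ] ℝ)) x := by
      have h1 : HasFDerivAt (fun x : Euc n => ⟪x, ξ⟫) (innerSL ℝ ξ : Euc n →L[ℝ] ℝ) x := by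
        have h2 := (innerSL ℝ ξ : Euc n →L[ℝ] ℝ).hasFDerivAt (x := x)
        simp only [real_inner_comm ξ]
        exact h2
      exact h1.exp.const_mul _
    rw [h.fderiv]
    simp [stdVec, EuclideanSpace.inner_single_right]
    ring

end DiffOp

section Necessity

variable {n k : ℕ} {V W : Type*}
    [NormedAddCommGroup V] [InnerProductSpace ℝ V] [FiniteDimensional ℝ V]
    [NormedAddCommGroup W] [InnerProductSpace ℝ W] [FiniteDimensional ℝ W]

/-- The formal adjoint of `A`, up to the sign `(-1) ^ k`. -/
noncomputable def adjointApply (n k : ℕ) {V W : Type*}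
    [NormedAddCommGroup V] [InnerProductSpace ℝ V] [FiniteDimensional ℝ V]
    [NormedAddCommGroup W] [InnerProductSpace ℝ W] [FiniteDimensional ℝ W]
    (A : CoeffOp n k V W) (φ : Euc n → W) (x : Euc n) : V :=
  ∑ I : Fin k → Fin n, LinearMap.adjoint (A I) (dirDeriv n k I φ x)

lemma continuous_adjoint_dirDeriv (A : CoeffOp n k V W) {φ : Euc n → W} (hφ : IsTestFun n φ)
    (I : Fin k → Fin n) : Continuous fun x => LinearMap.adjoint (A I) (dirDeriv n k I φ x) :=
  (LinearMap.adjoint (A I)).continuous_of_finiteDimensional.comp (hφ.dirDeriv I).1.continuous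

lemma hasCompactSupport_adjoint_dirDeriv (A : CoeffOp n k V W) {φ : Euc n → W}
    (hφ : IsTestFun n φ) (I : Fin k → Fin n) :
    HasCompactSupport fun x => LinearMap.adjoint (A I) (dirDeriv n k I φ x) :=
  (hφ.dirDeriv I).2.comp_left (map_zero (LinearMap.adjoint (A I)))

lemma continuous_adjointApply (A : CoeffOp n k V W) {φ : Euc n → W} (hφ : IsTestFun n φ) :
    Continuous (adjointApply n k A φ) :=
  continuous_finsetSum _ fun I _ => continuous_adjoint_dirDeriv A hφ I

lemma hasCompactSupport_adjointApply (A : CoeffOp n k V W) {φ : Euc n → W}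
    (hφ : IsTestFun n φ) : HasCompactSupport (adjointApply n k A φ) := by
  refine HasCompactSupport.intro (K := tsupport φ) hφ.2 fun x hx => ?_
  refine Finset.sum_eq_zero fun I _ => ?_
  have h : iteratedFDeriv ℝ k φ x = 0 := by
    by_contra h
    exact hx (support_iteratedFDeriv_subset k h)
  simp [dirDeriv, h]

omit [FiniteDimensional ℝ V] in
lemma integrable_inner_of_hasCompactSupport {u g : Euc n → V} (hu : LocallyIntegrable u volume)
    (hg : Continuous g) (hgc : HasCompactSupport g) : Integrable fun x => ⟪u x, g x⟫ := by
  obtain ⟨C, hC⟩ := hg.bounded_above_of_compact_support hgc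
  have h1 : IntegrableOn (fun x => ⟪u x, g x⟫) (tsupport g) := by
    refine ((hu.integrableOn_isCompact hgc).norm.const_mul C).mono'
      ((hu.integrableOn_isCompact hgc).1.inner hg.aestronglyMeasurable) ?_
    refine Eventually.of_forall fun x => (norm_inner_le_norm _ _).trans ?_
    rw [mul_comm]
    exact mul_le_mul_of_nonneg_right (hC x) (norm_nonneg _)
  refine (integrableOn_iff_integrable_of_support_subset fun x hx => ?_).1 h1
  refine subset_tsupport g fun h => hx ?_
  simp [h]

lemma sum_integral_inner_adjoint (A : CoeffOp n k V W) {u : Euc n → V}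
    (hu : LocallyIntegrable u volume) {φ : Euc n → W} (hφ : IsTestFun n φ) :
    ∑ I : Fin k → Fin n, ∫ x, ⟪u x, LinearMap.adjoint (A I) (dirDeriv n k I φ x)⟫ =
      ∫ x, ⟪u x, adjointApply n k A φ x⟫ := by
  simp only [adjointApply, inner_sum]
  exact (integral_finsetSum _ fun I _ => integrable_inner_of_hasCompactSupport hu
    (continuous_adjoint_dirDeriv A hφ I) (hasCompactSupport_adjoint_dirDeriv A hφ I)).symm

lemma adjointApply_sum_smul (A : CoeffOp n k V W)
    {Φ : MvPolynomial (Fin n) ℝ →ₐ[ℝ] Module.End ℝ (testSpace n)}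
    (hΦ : ∀ i, Φ (MvPolynomial.X i) = partialDeriv i)
    {p : Fin (Module.finrank ℝ W) → MvPolynomial (Fin n) ℝ}
    (hp : ∀ a, ∑ c, p c * symbolMatrix n k A c a = 0) (ψ : testSpace n) (x : Euc n) :
    adjointApply n k A (fun x => ∑ c, (Φ (p c) ψ).1 x • stdOrthonormalBasis ℝ W c) x = 0 := by
  rw [← (stdOrthonormalBasis ℝ V).sum_repr' (adjointApply n k A _ x)]
  refine Finset.sum_eq_zero fun a _ => ?_
  suffices h : ⟪stdOrthonormalBasis ℝ V a, adjointApply n k A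
      (fun x => ∑ c, (Φ (p c) ψ).1 x • stdOrthonormalBasis ℝ W c) x⟫ =
      (Φ (∑ c, p c * symbolMatrix n k A c a) ψ).1 x by
    rw [h, hp]
    simp
  simp only [adjointApply, dirDeriv_sum_smul hΦ, inner_sum, LinearMap.adjoint_inner_right,
    inner_smul_right, symbolMatrix, Matrix.of_apply, Finset.mul_sum, map_sum]
  rw [Finset.sum_comm]
  simp only [LinearMap.sum_apply, Submodule.coe_sum, Finset.sum_apply]
  refine Finset.sum_congr rfl fun c _ => Finset.sum_congr rfl fun I _ => ?_
  rw [mul_left_comm, map_mul, MvPolynomial.C_eq_algebraMap, AlgHom.commutes, mul_comm (p c),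
    map_mul, real_inner_comm, mul_comm]
  rfl

/-- If `A u = δ₀ w` has a locally integrable solution, then `w` lies in the range of the
symbol at every nonzero frequency. -/
lemma mem_range_symbolMap_of_hasDistribADirac {A : CoeffOp n k V W} (hell : IsElliptic n k A)
    {u : Euc n → V} (hu : LocallyIntegrable u volume) {w : W}
    (huw : HasDistribADirac n k A u w) {ξ : Euc n} (hξ : ξ ≠ 0) :
    w ∈ LinearMap.range (symbolMap n k A ξ) := by
  obtain ⟨q, G, hG, hq⟩ := exists_polynomial_leftInverse hell
  obtain ⟨Φ, hΦ⟩ := exists_constCoeff n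
  set S := symbolMatrix n k A with hS
  set L : Matrix _ _ (MvPolynomial (Fin n) ℝ) :=
    q • (1 : Matrix (Fin (Module.finrank ℝ W)) (Fin (Module.finrank ℝ W))
      (MvPolynomial (Fin n) ℝ)) - S * G with hL
  have hLS : L * S = 0 := by
    rw [hL, Matrix.sub_mul, Matrix.mul_assoc, hG]
    simp
  let χ : ContDiffBump (0 : Euc n) := default
  let ψ : testSpace n := ⟨fun x => χ x * Real.exp ⟪x, ξ⟫,
    χ.contDiff.mul (contDiff_id.inner ℝ contDiff_const).exp, χ.hasCompactSupport.mul_right⟩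
  have hψ : ψ.1 =ᶠ[𝓝 0] fun x => Real.exp ⟪x, ξ⟫ := by
    filter_upwards [χ.eventuallyEq_one] with x hx
    simp [ψ, hx]
  have hrow : ∀ r, ∑ c, MvPolynomial.eval ξ (L r c) * ⟪stdOrthonormalBasis ℝ W c, w⟫ = 0 := by
    intro r
    have hp : ∀ a, ∑ c, L r c * S c a = 0 := fun a => by
      rw [← Matrix.mul_apply, hLS, Matrix.zero_apply]
    set φ : Euc n → W := fun x => ∑ c, (Φ (L r c) ψ).1 x • stdOrthonormalBasis ℝ W c with hφd
    have hφ : IsTestFun n φ := by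
      refine ⟨ContDiff.sum fun c _ => (Subtype.prop (Φ (L r c) ψ)).1.smul contDiff_const, ?_⟩
      have h := fun c => (Subtype.prop (Φ (L r c) ψ)).2.smul_right
        (f' := fun _ : Euc n => stdOrthonormalBasis ℝ W c)
      have hfin : ∀ s : Finset (Fin (Module.finrank ℝ W)), HasCompactSupport
          (∑ c ∈ s, fun x => (Φ (L r c) ψ).1 x • stdOrthonormalBasis ℝ W c) := by
        intro s
        induction s using Finset.cons_induction with
        | empty => simpa using HasCompactSupport.zero
        | cons c s hc ih =>
          rw [Finset.sum_cons]
          exact (h c).add ih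
      convert hfin Finset.univ using 1
      ext x
      simp [hφd]
    have h0 := huw φ hφ
    rw [sum_integral_inner_adjoint A hu hφ] at h0
    simp only [hφd, adjointApply_sum_smul A hΦ hp, inner_zero_right, integral_zero, mul_zero,
      inner_sum, inner_smul_right] at h0
    rw [h0]
    refine Finset.sum_congr rfl fun c _ => ?_
    rw [(constCoeff_exp hΦ (L r c) ξ hψ).self_of_nhds]
    simp [real_inner_comm]
  let y : Fin (Module.finrank ℝ V) → ℝ := fun a =>
    ∑ c, MvPolynomial.eval ξ (G a c) * ⟪stdOrthonormalBasis ℝ W c, w⟫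
  refine ⟨(MvPolynomial.eval ξ q)⁻¹ • ∑ a, y a • stdOrthonormalBasis ℝ V a, ?_⟩
  rw [map_smul, inv_smul_eq_iff₀ (hq ξ hξ)]
  rw [← (stdOrthonormalBasis ℝ W).sum_repr' (symbolMap n k A ξ _),
    ← (stdOrthonormalBasis ℝ W).sum_repr' (MvPolynomial.eval (ξ : Fin n → ℝ) q • w)]
  refine Finset.sum_congr rfl fun r _ => ?_
  congr 1
  have h1 := hrow r
  simp only [hL, Matrix.sub_apply, map_sub, sub_mul, Finset.sum_sub_distrib, sub_eq_zero,
    Matrix.smul_apply, Matrix.one_apply, smul_eq_mul, mul_ite, mul_one, mul_zero, Matrix.mul_apply,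
    map_sum, map_mul, apply_ite (MvPolynomial.eval (ξ : Fin n → ℝ)), map_zero, ite_mul, zero_mul,
    Finset.sum_ite_eq, Finset.mem_univ, if_true] at h1
  rw [symbolMap_repr, inner_smul_right, h1]
  simp only [Matrix.mulVec, dotProduct, inner_sum, inner_smul_right,
    OrthonormalBasis.inner_eq_ite, mul_ite, mul_one, mul_zero, Finset.sum_ite_eq, Finset.mem_univ,
    if_true, y, Finset.mul_sum, Finset.sum_mul, Matrix.map_apply]
  rw [Finset.sum_comm]
  simp only [mul_assoc, ← hS]

end Necessity

section PlaneWaves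

/-- Successive primitives of the function `s ↦ cos (2 π s)`. -/
def IsPhase (h : ℕ → ℝ → ℝ) : Prop :=
  (∀ s, h 0 s = Real.cos (2 * Real.pi * s)) ∧ ∀ j s, HasDerivAt (h (j + 1)) (h j s) s

/-- Bounded primitives of `s ↦ cos (2 π s)`. -/
noncomputable def boundedPhase (j : ℕ) (s : ℝ) : ℝ :=
  ((2 * Real.pi) ^ j)⁻¹ * Real.cos (2 * Real.pi * s - j * (Real.pi / 2))

/-- Primitives of `s ↦ cos (2 π s)` vanishing to maximal order at the origin. -/
noncomputable def vanishingPhase : ℕ → ℝ → ℝ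
  | 0 => fun s => Real.cos (2 * Real.pi * s)
  | j + 1 => fun s => ∫ t in (0 : ℝ)..s, vanishingPhase j t

lemma isPhase_boundedPhase : IsPhase boundedPhase := by
  refine ⟨fun s => by simp [boundedPhase], fun j s => ?_⟩
  have h1 : HasDerivAt (fun s : ℝ => 2 * Real.pi * s - ((j + 1 : ℕ) : ℝ) * (Real.pi / 2))
      (2 * Real.pi) s := by
    simpa using ((hasDerivAt_id s).const_mul (2 * Real.pi)).sub_const
      (((j + 1 : ℕ) : ℝ) * (Real.pi / 2))
  have h2 := h1.cos.const_mul ((2 * Real.pi) ^ (j + 1))⁻¹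
  refine h2.congr_deriv ?_
  have h3 : 2 * Real.pi * s - ((j + 1 : ℕ) : ℝ) * (Real.pi / 2) =
      2 * Real.pi * s - j * (Real.pi / 2) - Real.pi / 2 := by
    push_cast
    ring
  rw [h3, Real.sin_sub_pi_div_two, boundedPhase, pow_succ]
  field_simp [Real.pi_ne_zero]

lemma abs_boundedPhase_le (j : ℕ) (s : ℝ) : |boundedPhase j s| ≤ 1 := by
  rw [boundedPhase, abs_mul, abs_inv, abs_of_pos (by positivity)]
  refine mul_le_one₀ (inv_le_one_of_one_le₀ (one_le_pow₀ ?_)) (abs_nonneg _)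
    (Real.abs_cos_le_one _)
  nlinarith [Real.pi_gt_three]

lemma continuous_vanishingPhase (j : ℕ) : Continuous (vanishingPhase j) := by
  induction j with
  | zero => exact Real.continuous_cos.comp (continuous_const.mul continuous_id)
  | succ j ih =>
    exact intervalIntegral.continuous_primitive (fun a b => ih.intervalIntegrable a b) 0

lemma isPhase_vanishingPhase : IsPhase vanishingPhase :=
  ⟨fun _ => rfl, fun j s => (continuous_vanishingPhase j).integral_hasStrictDerivAt 0 s
    |>.hasDerivAt⟩

lemma abs_vanishingPhase_le (j : ℕ) (s : ℝ) : |vanishingPhase j s| ≤ |s| ^ j := by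
  induction j generalizing s with
  | zero => simpa [vanishingPhase] using Real.abs_cos_le_one _
  | succ j ih =>
    have h := intervalIntegral.norm_integral_le_of_norm_le_const (a := (0 : ℝ)) (b := s)
      (f := vanishingPhase j) (C := |s| ^ j) fun t ht => (ih t).trans (by
        refine pow_le_pow_left₀ (abs_nonneg _) ?_ _
        rcases Set.mem_uIoc.1 ht with ht | ht
        · exact abs_le_abs ht.2 (by linarith)
        · rw [abs_of_nonpos ht.2, abs_of_neg (ht.1.trans_le ht.2)]
          linarith)
    simpa [vanishingPhase, pow_succ] using h

lemma IsPhase.continuous {h : ℕ → ℝ → ℝ} (hh : IsPhase h) (j : ℕ) : Continuous (h j) := by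
  cases j with
  | zero =>
    rw [show h 0 = _ from funext hh.1]
    exact Real.continuous_cos.comp (continuous_const.mul continuous_id)
  | succ j => exact continuous_iff_continuousAt.2 fun s => (hh.2 j s).continuousAt

lemma IsPhase.integral_smul_fderiv {h : ℕ → ℝ → ℝ} (hh : IsPhase h) {n : ℕ} {F : Type*}
    [NormedAddCommGroup F] [NormedSpace ℝ F] {φ : Euc n → F} (hφ : IsTestFun n φ) (j : ℕ)
    (ξ : Euc n) (i : Fin n) :
    ∫ x, h (j + 1) ⟪x, ξ⟫ • fderiv ℝ φ x (stdVec n i) =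
      -(ξ i • ∫ x, h j ⟪x, ξ⟫ • φ x) := by
  have hd : ∀ x : Euc n, HasFDerivAt (fun x : Euc n => h (j + 1) ⟪x, ξ⟫)
      (h j ⟪x, ξ⟫ • (innerSL ℝ ξ : Euc n →L[ℝ] ℝ)) x := by
    intro x
    have h1 : HasFDerivAt (fun x : Euc n => ⟪x, ξ⟫) (innerSL ℝ ξ : Euc n →L[ℝ] ℝ) x := by
      have h2 := (innerSL ℝ ξ : Euc n →L[ℝ] ℝ).hasFDerivAt (x := x)
      simp only [real_inner_comm ξ]
      exact h2
    exact (hh.2 j _).comp_hasFDerivAt x h1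
  have hc : ∀ m, Continuous fun x : Euc n => h m ⟪x, ξ⟫ := fun m =>
    (hh.continuous m).comp (by fun_prop)
  have hφ' := hφ.fderiv_apply (stdVec n i)
  have heq : ∀ x, fderiv ℝ (fun x : Euc n => h (j + 1) ⟪x, ξ⟫) x (stdVec n i) • φ x =
      ξ i • h j ⟪x, ξ⟫ • φ x := by
    intro x
    rw [(hd x).fderiv]
    simp [stdVec, EuclideanSpace.inner_single_right, smul_smul, mul_comm]
  have hmint : Integrable fun x => h j ⟪x, ξ⟫ • φ x :=
    ((hc j).smul hφ.1.continuous).integrable_of_hasCompactSupport (hφ.2.smul_left)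
  rw [integral_smul_fderiv_eq_neg_fderiv_smul_of_integrable]
  · simp only [heq]
    rw [integral_smul]
  · simp only [heq]
    exact hmint.smul _
  · exact ((hc _).smul hφ'.1.continuous).integrable_of_hasCompactSupport (hφ'.2.smul_left)
  · exact ((hc _).smul hφ.1.continuous).integrable_of_hasCompactSupport (hφ.2.smul_left)
  · exact fun x _ => (hd x).differentiableAt
  · exact fun x _ => hφ.1.differentiable (by simp) x

lemma IsPhase.integral_smul_dirDeriv {h : ℕ → ℝ → ℝ} (hh : IsPhase h) {n : ℕ} {F : Type*}
    [NormedAddCommGroup F] [NormedSpace ℝ F] {φ : Euc n → F} (hφ : IsTestFun n φ) {k : ℕ}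
    (I : Fin k → Fin n) (ξ : Euc n) :
    ∫ x, h k ⟪x, ξ⟫ • dirDeriv n k I φ x =
      ((-1) ^ k * ∏ i, ξ (I i)) • ∫ x, Real.cos (2 * Real.pi * ⟪x, ξ⟫) • φ x := by
  induction k with
  | zero => simp [dirDeriv_zero, hh.1]
  | succ k ih =>
    simp only [dirDeriv_succ hφ.1]
    rw [hh.integral_smul_fderiv (hφ.dirDeriv _), ih, Fin.prod_univ_succ, smul_smul, ← neg_smul]
    congr 1
    simp only [Fin.tail]
    ring

variable {n k : ℕ} {V W : Type*}
    [NormedAddCommGroup V] [InnerProductSpace ℝ V] [FiniteDimensional ℝ V]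
    [NormedAddCommGroup W] [InnerProductSpace ℝ W] [FiniteDimensional ℝ W]

lemma IsPhase.integral_smul_adjointApply {h : ℕ → ℝ → ℝ} (hh : IsPhase h) (A : CoeffOp n k V W)
    {φ : Euc n → W} (hφ : IsTestFun n φ) (ξ : Euc n) (v : V) :
    ∫ x, h k ⟪x, ξ⟫ * ⟪v, adjointApply n k A φ x⟫ =
      (-1) ^ k * ∫ x, Real.cos (2 * Real.pi * ⟪x, ξ⟫) * ⟪symbolMap n k A ξ v, φ x⟫ := by
  have hc : Continuous fun x : Euc n => h k ⟪x, ξ⟫ := (hh.continuous k).comp (by fun_prop)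
  have hmint : ∀ I : Fin k → Fin n, Integrable fun x => h k ⟪x, ξ⟫ • dirDeriv n k I φ x :=
    fun I => (hc.smul (hφ.dirDeriv I).1.continuous).integrable_of_hasCompactSupport
      ((hφ.dirDeriv I).2.smul_left)
  have hmint' : Integrable fun x => Real.cos (2 * Real.pi * ⟪x, ξ⟫) • φ x :=
    (Continuous.smul (by fun_prop) hφ.1.continuous).integrable_of_hasCompactSupport
      (hφ.2.smul_left)
  have h1 : ∀ x, h k ⟪x, ξ⟫ * ⟪v, adjointApply n k A φ x⟫ =
      ∑ I : Fin k → Fin n, ⟪A I v, h k ⟪x, ξ⟫ • dirDeriv n k I φ x⟫ := by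
    intro x
    simp [adjointApply, inner_sum, LinearMap.adjoint_inner_right, inner_smul_right,
      Finset.mul_sum]
  have h2 : ∀ x, Real.cos (2 * Real.pi * ⟪x, ξ⟫) * ⟪symbolMap n k A ξ v, φ x⟫ =
      ⟪symbolMap n k A ξ v, Real.cos (2 * Real.pi * ⟪x, ξ⟫) • φ x⟫ := by
    intro x
    rw [inner_smul_right]
  simp only [h1, h2]
  rw [integral_finsetSum _ fun I _ => (hmint I).const_inner _, integral_inner hmint']
  have h3 : ∀ I : Fin k → Fin n, ∫ x, ⟪A I v, h k ⟪x, ξ⟫ • dirDeriv n k I φ x⟫ =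
      ((-1) ^ k * ∏ i, ξ (I i)) * ⟪A I v, ∫ x, Real.cos (2 * Real.pi * ⟪x, ξ⟫) • φ x⟫ :=
    fun I => by
      rw [integral_inner (hmint I), hh.integral_smul_dirDeriv hφ, inner_smul_right]
  simp only [h3]
  simp [symbolMap, sum_inner, inner_smul_left, Finset.mul_sum, mul_assoc]

/-- The superposition of plane waves with profile `h` and amplitude `m`. -/
noncomputable def planeWaves (h : ℝ → ℝ) (m : Euc n → V) (x : Euc n) : V :=
  ∫ ξ, h ⟪x, ξ⟫ • m ξ

/-- The cosine transform of `⟪w, φ⟫`. -/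
noncomputable def cosTransform (w : W) (φ : Euc n → W) (ξ : Euc n) : ℝ :=
  ∫ x, Real.cos (2 * Real.pi * ⟪x, ξ⟫) * ⟪w, φ x⟫

omit [FiniteDimensional ℝ V] in
lemma aestronglyMeasurable_planeWave {h : ℝ → ℝ} (hh : Continuous h) {m : Euc n → V}
    (hm : AEStronglyMeasurable m) :
    AEStronglyMeasurable (fun z : Euc n × Euc n => h ⟪z.1, z.2⟫ • m z.2)
      (volume.prod volume) :=
  AEStronglyMeasurable.smul (hh.comp (by fun_prop)).aestronglyMeasurable hm.comp_snd

omit [FiniteDimensional ℝ V] in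
lemma locallyIntegrable_planeWaves {h : ℝ → ℝ} (hh : Continuous h) {m : Euc n → V}
    (hm : AEStronglyMeasurable m) {B : Euc n → ℝ} (hB : Integrable B) {N : ℕ}
    (hmB : ∀ x ξ : Euc n, ‖h ⟪x, ξ⟫ • m ξ‖ ≤ (1 + ‖x‖) ^ N * B ξ) :
    LocallyIntegrable (planeWaves h m) := by
  have hc : Continuous fun x : Euc n => (1 + ‖x‖) ^ N * ∫ ξ, B ξ := by fun_prop
  refine hc.locallyIntegrable.mono
    (aestronglyMeasurable_planeWave hh hm).integral_prod_right' ?_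
  refine Eventually.of_forall fun x => ?_
  rw [← integral_const_mul]
  refine (norm_integral_le_of_norm_le (hB.const_mul _)
    (Eventually.of_forall (hmB x))).trans (le_abs_self _)

lemma IsPhase.integral_planeWaves {h : ℕ → ℝ → ℝ} (hh : IsPhase h) (A : CoeffOp n k V W)
    {m : Euc n → V} (hm : AEStronglyMeasurable m) {B : Euc n → ℝ} (hB : Integrable B) {N : ℕ}
    (hmB : ∀ x ξ : Euc n, ‖h k ⟪x, ξ⟫ • m ξ‖ ≤ (1 + ‖x‖) ^ N * B ξ) {χ : Euc n → ℝ} {w : W}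
    (hχ : ∀ᵐ ξ : Euc n, symbolMap n k A ξ (m ξ) = χ ξ • w) {φ : Euc n → W}
    (hφ : IsTestFun n φ) :
    (-1) ^ k * ∫ x, ⟪planeWaves (h k) m x, adjointApply n k A φ x⟫ =
      ∫ ξ, χ ξ * cosTransform w φ ξ := by
  set g := adjointApply n k A φ with hg
  have hgc : Continuous g := continuous_adjointApply A hφ
  have hgs : HasCompactSupport g := hasCompactSupport_adjointApply A hφ
  have hmint : Integrable (fun z : Euc n × Euc n => ⟪h k ⟪z.1, z.2⟫ • m z.2, g z.1⟫)
      (volume.prod volume) := by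
    have hdom : Integrable (fun z : Euc n × Euc n => ((1 + ‖z.1‖) ^ N * ‖g z.1‖) * B z.2)
        (volume.prod volume) := by
      refine Integrable.mul_prod (f := fun x : Euc n => (1 + ‖x‖) ^ N * ‖g x‖) ?_ hB
      exact Continuous.integrable_of_hasCompactSupport (by fun_prop) hgs.norm.mul_left
    refine hdom.mono' ((aestronglyMeasurable_planeWave (hh.continuous k) hm).inner
      (hgc.comp continuous_fst).aestronglyMeasurable) (Eventually.of_forall fun z => ?_)
    refine (norm_inner_le_norm _ _).trans ?_
    calc _ ≤ ((1 + ‖z.1‖) ^ N * B z.2) * ‖g z.1‖ :=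
          mul_le_mul_of_nonneg_right (hmB _ _) (norm_nonneg _)
      _ = _ := by ring
  have h1 : ∀ x, ⟪planeWaves (h k) m x, g x⟫ = ∫ ξ, ⟪h k ⟪x, ξ⟫ • m ξ, g x⟫ := by
    intro x
    have hx : Integrable fun ξ => h k ⟪x, ξ⟫ • m ξ := by
      refine (hB.const_mul ((1 + ‖x‖) ^ N)).mono' ?_ (Eventually.of_forall (hmB x))
      have hcx : Continuous fun ξ : Euc n => h k ⟪x, ξ⟫ :=
        (hh.continuous k).comp (by fun_prop)
      exact hcx.aestronglyMeasurable.smul hm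
    have h2 := integral_inner (𝕜 := ℝ) hx (g x)
    rw [real_inner_comm, planeWaves, ← h2]
    exact integral_congr_ae (Eventually.of_forall fun ξ => real_inner_comm _ _)
  simp only [h1]
  rw [integral_integral_swap hmint, ← integral_const_mul]
  refine integral_congr_ae ?_
  filter_upwards [hχ] with ξ hξ
  have h2 := hh.integral_smul_adjointApply A hφ ξ (m ξ)
  have h3 : ∀ x, Real.cos (2 * Real.pi * ⟪x, ξ⟫) * ⟪symbolMap n k A ξ (m ξ), φ x⟫ =
      χ ξ * (Real.cos (2 * Real.pi * ⟪x, ξ⟫) * ⟪w, φ x⟫) := by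
    intro x
    rw [hξ, real_inner_smul_left]
    ring
  simp only [real_inner_smul_left, ← hg, h3, integral_const_mul] at h2 ⊢
  rw [h2, ← mul_assoc, ← mul_pow, cosTransform]
  norm_num

end PlaneWaves

section FourierSide

variable {n : ℕ}

open scoped FourierTransform

lemma IsTestFun.ofReal {f : Euc n → ℝ} (hf : IsTestFun n f) :
    IsTestFun n fun x => (f x : ℂ) :=
  ⟨Complex.ofRealCLM.contDiff.comp hf.1, hf.2.comp_left Complex.ofReal_zero⟩

lemma IsTestFun.integrable {F : Type*} [NormedAddCommGroup F] [NormedSpace ℝ F]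
    {f : Euc n → F} (hf : IsTestFun n f) : Integrable f :=
  hf.1.continuous.integrable_of_hasCompactSupport hf.2

lemma IsTestFun.integrable_fourier {f : Euc n → ℂ} (hf : IsTestFun n f) : Integrable (𝓕 f) := by
  have h := (𝓕 (hf.2.toSchwartzMap hf.1)).integrable (μ := volume)
  rwa [SchwartzMap.fourier_coe] at h

lemma IsTestFun.integral_fourier {f : Euc n → ℂ} (hf : IsTestFun n f) :
    ∫ ξ, 𝓕 f ξ = f 0 := by
  have h := congrFun (hf.1.continuous.fourierInv_fourier_eq hf.integrable
    hf.integrable_fourier) 0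
  rw [Real.fourierInv_eq] at h
  simpa using h

lemma integral_cos_sub_mul_eq_re {f : Euc n → ℝ} (hf : Integrable f) (θ : ℝ) (x : Euc n) :
    ∫ ξ, Real.cos (2 * Real.pi * ⟪ξ, x⟫ - θ) * f ξ =
      (Complex.exp (θ * Complex.I) * 𝓕 (fun ξ => (f ξ : ℂ)) x).re := by
  have h1 : Integrable fun ξ => Real.fourierChar (-⟪ξ, x⟫) • (f ξ : ℂ) :=
    (Real.fourierIntegral_convergent_iff (μ := volume) x).2 hf.ofReal
  rw [Real.fourier_eq, ← integral_const_mul]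
  have h2 := integral_re (h1.const_mul (Complex.exp (θ * Complex.I)))
  simp only [RCLike.re_to_complex] at h2
  rw [← h2]
  refine integral_congr_ae (Eventually.of_forall fun ξ => ?_)
  simp only [Circle.smul_def, Real.fourierChar_apply, smul_eq_mul]
  rw [← mul_assoc, ← Complex.exp_add, Complex.re_mul_ofReal, ← add_mul]
  rw [show (θ : ℂ) + ((2 * Real.pi * -⟪ξ, x⟫ : ℝ) : ℂ) =
    ((-(2 * Real.pi * ⟪ξ, x⟫ - θ) : ℝ) : ℂ) by push_cast; ring, Complex.exp_ofReal_mul_I_re,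
    Real.cos_neg]

variable {k : ℕ} {V W : Type*}
    [NormedAddCommGroup V] [InnerProductSpace ℝ V] [FiniteDimensional ℝ V]
    [NormedAddCommGroup W] [InnerProductSpace ℝ W] [FiniteDimensional ℝ W]

omit [FiniteDimensional ℝ V] in
lemma IsTestFun.const_inner {φ : Euc n → V} (hφ : IsTestFun n φ) (w : V) :
    IsTestFun n fun x => ⟪w, φ x⟫ :=
  ⟨contDiff_const.inner ℝ hφ.1, hφ.2.comp_left (inner_zero_right w)⟩

omit [FiniteDimensional ℝ V] in
lemma cosTransform_eq {φ : Euc n → V} (hφ : IsTestFun n φ) (w : V) (ξ : Euc n) :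
    cosTransform w φ ξ = (𝓕 (fun x => (⟪w, φ x⟫ : ℂ)) ξ).re := by
  simpa [cosTransform] using integral_cos_sub_mul_eq_re (hφ.const_inner w).integrable 0 ξ

omit [FiniteDimensional ℝ V] in
lemma integrable_cosTransform {φ : Euc n → V} (hφ : IsTestFun n φ) (w : V) :
    Integrable (cosTransform w φ) := by
  rw [show cosTransform w φ = _ from funext (cosTransform_eq hφ w)]
  exact (hφ.const_inner w).ofReal.integrable_fourier.re

omit [FiniteDimensional ℝ V] in
lemma integral_cosTransform {φ : Euc n → V} (hφ : IsTestFun n φ) (w : V) :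
    ∫ ξ, cosTransform w φ ξ = ⟪w, φ 0⟫ := by
  simp only [cosTransform_eq hφ w]
  have h := integral_re (hφ.const_inner w).ofReal.integrable_fourier
  simp only [RCLike.re_to_complex] at h
  rw [h, (hφ.const_inner w).ofReal.integral_fourier, Complex.ofReal_re]

lemma integrable_planeWaves_boundedPhase {m : Euc n → V} (hm : IsTestFun n m) (k : ℕ) :
    Integrable (planeWaves (boundedPhase k) m) := by
  have hc : ∀ x : Euc n, Continuous fun ξ : Euc n => boundedPhase k ⟪x, ξ⟫ := fun x =>
    (isPhase_boundedPhase.continuous k).comp (by fun_prop)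
  have h1 : ∀ x, planeWaves (boundedPhase k) m x = ∑ a,
      (((2 * Real.pi) ^ k)⁻¹ * (Complex.exp ((k * (Real.pi / 2) : ℝ) * Complex.I) *
        𝓕 (fun ξ => (⟪stdOrthonormalBasis ℝ V a, m ξ⟫ : ℂ)) x).re) •
          stdOrthonormalBasis ℝ V a := by
    intro x
    have hmint : Integrable fun ξ => boundedPhase k ⟪x, ξ⟫ • m ξ :=
      ((hc x).smul hm.1.continuous).integrable_of_hasCompactSupport hm.2.smul_left
    rw [← (stdOrthonormalBasis ℝ V).sum_repr' (planeWaves _ _ x)]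
    refine Finset.sum_congr rfl fun a _ => ?_
    have h2 := integral_inner (𝕜 := ℝ) hmint (stdOrthonormalBasis ℝ V a)
    rw [planeWaves, ← h2, ← integral_cos_sub_mul_eq_re (hm.const_inner _).integrable,
      ← integral_const_mul]
    congr 1
    refine integral_congr_ae (Eventually.of_forall fun ξ => ?_)
    simp only [inner_smul_right, boundedPhase, real_inner_comm x]
    ring
  rw [show planeWaves (boundedPhase k) m = _ from funext h1]
  refine integrable_finsetSum _ fun a _ => Integrable.smul_const ?_ _
  exact (((hm.const_inner _).ofReal.integrable_fourier.const_mul _).re).const_mul _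

omit [FiniteDimensional ℝ V] in
lemma planeWaves_comp_inv_smul (h : ℝ → ℝ) (m : Euc n → V) {c : ℝ} (hc : 0 < c) (x : Euc n) :
    planeWaves h (fun ξ => m (c⁻¹ • ξ)) x = c ^ n • planeWaves h m (c • x) := by
  have h1 := Measure.integral_comp_smul (μ := (volume : Measure (Euc n)))
    (fun η : Euc n => h ⟪c • x, η⟫ • m η) c⁻¹
  simp only [finrank_euclideanSpace_fin, inner_smul_left, inner_smul_right] at h1
  rw [abs_of_pos (by positivity), inv_pow, inv_inv] at h1
  simp only [planeWaves, inner_smul_left, ← h1]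
  simp [hc.ne']

omit [FiniteDimensional ℝ V] in
lemma integral_norm_planeWaves_comp_inv_smul (h : ℝ → ℝ) (m : Euc n → V) {c : ℝ} (hc : 0 < c) :
    ∫ x, ‖planeWaves h (fun ξ => m (c⁻¹ • ξ)) x‖ = ∫ x, ‖planeWaves h m x‖ := by
  simp only [planeWaves_comp_inv_smul h m hc, norm_smul]
  rw [integral_const_mul, Measure.integral_comp_smul (μ := (volume : Measure (Euc n)))
    (fun x => ‖planeWaves h m x‖) c]
  simp only [finrank_euclideanSpace_fin, smul_eq_mul, ← mul_assoc, norm_pow,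
    Real.norm_of_nonneg hc.le]
  rw [abs_of_pos (by positivity), mul_inv_cancel₀ (by positivity), one_mul]

lemma exists_integrable_hasSum_integral_inner {U : ℕ → Euc n → V} (hU : ∀ j, Integrable (U j))
    (hs : Summable fun j => ∫ x, ‖U j x‖) :
    ∃ u : Euc n → V, Integrable u ∧ ∀ g : Euc n → V, Continuous g → HasCompactSupport g →
      HasSum (fun j => ∫ x, ⟪U j x, g x⟫) (∫ x, ⟪u x, g x⟫) := by
  have h1 : ∑' j, ‖(hU j).toL1‖ₑ ≠ ∞ := by
    refine tsum_enorm_ne_top_iff_summable_norm.2 ?_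
    simpa only [L1.norm_of_fun_eq_integral_norm] using hs
  refine ⟨_, L1.integrable_coeFn (∑' j, (hU j).toL1), fun g hg hgc => ?_⟩
  obtain ⟨C, hC⟩ := hg.bounded_above_of_compact_support hgc
  have h2 := hasSum_integral_of_summable_integral_norm (μ := (volume : Measure (Euc n)))
    (F := fun j x => ⟪U j x, g x⟫)
    (fun j => integrable_inner_of_hasCompactSupport (hU j).locallyIntegrable hg hgc) (by
      refine Summable.of_nonneg_of_le (fun j => integral_nonneg fun x => norm_nonneg _)
        (fun j => ?_) (hs.mul_right C)
      rw [← integral_mul_const]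
      refine integral_mono (integrable_inner_of_hasCompactSupport
        (hU j).locallyIntegrable hg hgc).norm ((hU j).norm.mul_const C) fun x => ?_
      exact (norm_inner_le_norm _ _).trans
        (mul_le_mul_of_nonneg_left (hC x) (norm_nonneg _)))
  have h3 : ∫ x, ∑' j, ⟪U j x, g x⟫ =
      ∫ x, ⟪(∑' j, (hU j).toL1 : Lp V 1 (volume : Measure (Euc n))) x, g x⟫ := by
    refine integral_congr_ae ?_
    filter_upwards [Lp.hasSum_coeFn_tsum h1, ae_all_iff.2 fun j => (hU j).coeFn_toL1]
      with x hx hx'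
    simp only [hx'] at hx
    have h4 := (innerSL ℝ (g x)).hasSum hx
    simp only [innerSL_apply_apply, real_inner_comm] at h4
    simpa only [real_inner_comm] using h4.tsum_eq
  rwa [h3] at h2

end FourierSide

section Sufficiency

variable {n k : ℕ} {V W : Type*}
    [NormedAddCommGroup V] [InnerProductSpace ℝ V] [FiniteDimensional ℝ V]
    [NormedAddCommGroup W] [InnerProductSpace ℝ W] [FiniteDimensional ℝ W]

lemma contDiff_eval (p : MvPolynomial (Fin n) ℝ) :
    ContDiff ℝ (⊤ : ℕ∞) fun ξ : Euc n => MvPolynomial.eval ξ p := by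
  induction p using MvPolynomial.induction_on with
  | C a => simpa using contDiff_const
  | add p q hp hq => simpa using hp.add hq
  | mul_X p i hp =>
    simp only [map_mul, MvPolynomial.eval_X]
    exact hp.mul (contDiff_euclidean.1 contDiff_id i)

/-- A vector in all ranges of an elliptic symbol has a preimage depending smoothly on the
nonzero frequency. -/
lemma exists_symbolMap_eq {A : CoeffOp n k V W} (hell : IsElliptic n k A) {w : W}
    (hw : ∀ ξ : Euc n, ξ ≠ 0 → w ∈ LinearMap.range (symbolMap n k A ξ)) :
    ∃ b : Euc n → V, (∀ ξ, ξ ≠ 0 → symbolMap n k A ξ (b ξ) = w) ∧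
      ∀ ξ, ξ ≠ 0 → ContDiffAt ℝ (⊤ : ℕ∞) b ξ := by
  obtain ⟨q, G, hG, hq⟩ := exists_polynomial_leftInverse hell
  refine ⟨fun ξ => ∑ a, ((MvPolynomial.eval ξ q)⁻¹ * ∑ c, MvPolynomial.eval ξ (G a c) *
    ⟪stdOrthonormalBasis ℝ W c, w⟫) • stdOrthonormalBasis ℝ V a, fun ξ hξ => ?_, fun ξ hξ => ?_⟩
  · obtain ⟨v, rfl⟩ := hw ξ hξ
    congr 1
    conv_rhs => rw [← (stdOrthonormalBasis ℝ V).sum_repr' v]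
    refine Finset.sum_congr rfl fun a _ => ?_
    congr 1
    have h1 := congrArg (fun M => (M.map (MvPolynomial.eval (ξ : Fin n → ℝ))).mulVec
      (fun a => ⟪stdOrthonormalBasis ℝ V a, v⟫) a) hG
    simp only [Matrix.map_mul, ← Matrix.mulVec_mulVec] at h1
    rw [inv_mul_eq_iff_eq_mul₀ (hq ξ hξ)]
    simp only [symbolMap_repr]
    refine h1.trans ?_
    simp [Matrix.mulVec, dotProduct, Matrix.smul_apply, Matrix.one_apply, apply_ite]
  · refine ContDiffAt.sum fun a _ => ContDiffAt.smul (ContDiffAt.mul ?_ ?_) contDiffAt_const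
    · exact (contDiff_eval q).contDiffAt.inv (hq ξ hξ)
    · exact ContDiffAt.sum fun c _ => (contDiff_eval _).contDiffAt.mul contDiffAt_const

omit [FiniteDimensional ℝ V] [FiniteDimensional ℝ W] in
lemma exists_norm_pow_mul_le {A : CoeffOp n k V W} (hk : 1 ≤ k) (hell : IsElliptic n k A)
    {w : W} {b : Euc n → V} (hb : ∀ ξ, ξ ≠ 0 → symbolMap n k A ξ (b ξ) = w)
    (hbc : ∀ ξ, ξ ≠ 0 → ContDiffAt ℝ (⊤ : ℕ∞) b ξ) :
    ∃ C, 0 ≤ C ∧ ∀ ξ : Euc n, ‖ξ‖ ^ k * ‖b ξ‖ ≤ C := by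
  have h0 : ∀ ξ ∈ sphere (0 : Euc n) 1, ξ ≠ 0 := fun ξ hξ => by
    rintro rfl
    simp at hξ
  obtain ⟨C, hC⟩ := (isCompact_sphere (0 : Euc n) 1).exists_bound_of_continuousOn
    (f := b) fun ξ hξ => (hbc ξ (h0 ξ hξ)).continuousAt.continuousWithinAt
  refine ⟨max C 0, le_max_right _ _, fun ξ => ?_⟩
  rcases eq_or_ne ξ 0 with rfl | hξ
  · rw [norm_zero, zero_pow (by omega), zero_mul]
    exact le_max_right _ _
  · have hn : ‖ξ‖ ≠ 0 := norm_ne_zero_iff.2 hξ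
    set η := ‖ξ‖⁻¹ • ξ with hη
    have hη1 : η ∈ sphere (0 : Euc n) 1 := by simp [hη, norm_smul, hn]
    have h1 : b η = ‖ξ‖ ^ k • b ξ := by
      apply hell η (h0 η hη1)
      rw [hb η (h0 η hη1), hη, symbolMap_smul, LinearMap.smul_apply, map_smul, hb ξ hξ,
        smul_smul, ← mul_pow, inv_mul_cancel₀ hn, one_pow, one_smul]
    have h2 := (hC η hη1).trans (le_max_left C 0)
    rwa [h1, norm_smul, norm_pow, norm_norm] at h2

/-- If `w` lies in the range of the symbol at every nonzero frequency, then `A u = δ₀ w` has a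
locally integrable solution, a dyadic superposition of plane waves. -/
lemma exists_hasDistribADirac {A : CoeffOp n k V W} (hn : 1 ≤ n) (hk : 1 ≤ k)
    (hell : IsElliptic n k A) {w : W}
    (hw : ∀ ξ : Euc n, ξ ≠ 0 → w ∈ LinearMap.range (symbolMap n k A ξ)) :
    ∃ u : Euc n → V, LocallyIntegrable u volume ∧ HasDistribADirac n k A u w := by
  obtain ⟨b, hb, hbc⟩ := exists_symbolMap_eq hell hw
  obtain ⟨C, hC0, hC⟩ := exists_norm_pow_mul_le hk hell hb hbc
  have : Nonempty (Fin n) := ⟨⟨0, hn⟩⟩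
  have hae : ∀ᵐ ξ : Euc n, ξ ≠ 0 := by simp [ae_iff]
  let χ : ContDiffBump (0 : Euc n) := ⟨1, 2, one_pos, one_lt_two⟩
  have hχs : IsTestFun n χ := ⟨χ.contDiff, χ.hasCompactSupport⟩
  have hbm : AEStronglyMeasurable b := by
    have h1 : ContinuousOn b {0}ᶜ := fun ξ hξ => (hbc ξ hξ).continuousAt.continuousWithinAt
    have h2 := h1.aestronglyMeasurable (μ := volume) (measurableSet_singleton 0).compl
    rwa [Measure.restrict_eq_self_of_ae_mem (s := ({0}ᶜ : Set (Euc n))) hae] at h2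
  -- the low frequency part
  let mlow : Euc n → V := fun ξ => χ ξ • b ξ
  have hlowm : AEStronglyMeasurable mlow := χ.continuous.aestronglyMeasurable.smul hbm
  have hlowB : Integrable fun ξ => χ ξ * C := hχs.integrable.mul_const C
  have hlow : ∀ x ξ : Euc n, ‖vanishingPhase k ⟪x, ξ⟫ • mlow ξ‖ ≤
      (1 + ‖x‖) ^ k * (χ ξ * C) := by
    intro x ξ
    have h1 : |vanishingPhase k ⟪x, ξ⟫| ≤ (1 + ‖x‖) ^ k * ‖ξ‖ ^ k := by
      rw [← mul_pow]
      refine (abs_vanishingPhase_le k _).trans (pow_le_pow_left₀ (abs_nonneg _) ?_ _)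
      refine (abs_real_inner_le_norm _ _).trans
        (mul_le_mul_of_nonneg_right ?_ (norm_nonneg _))
      linarith
    rw [norm_smul, norm_smul, Real.norm_eq_abs, Real.norm_of_nonneg χ.nonneg]
    calc _ ≤ ((1 + ‖x‖) ^ k * ‖ξ‖ ^ k) * (χ ξ * ‖b ξ‖) :=
          mul_le_mul_of_nonneg_right h1 (mul_nonneg χ.nonneg (norm_nonneg _))
      _ = (1 + ‖x‖) ^ k * (χ ξ * (‖ξ‖ ^ k * ‖b ξ‖)) := by ring
      _ ≤ _ := by
        have := hC ξ
        have := χ.nonneg (x := ξ)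
        gcongr
  have hlowχ : ∀ᵐ ξ : Euc n, symbolMap n k A ξ (mlow ξ) = χ ξ • w := by
    filter_upwards [hae] with ξ hξ
    rw [map_smul, hb ξ hξ]
  -- the high frequency parts
  let ψ : Euc n → ℝ := fun ξ => χ ((2 : ℝ)⁻¹ • ξ) - χ ξ
  have hχ2 : IsTestFun n fun ξ => χ ((2 : ℝ)⁻¹ • ξ) :=
    ⟨χ.contDiff.comp (contDiff_const_smul _), hχs.2.comp_smul (by norm_num)⟩
  have hψc : ContDiff ℝ (⊤ : ℕ∞) ψ := hχ2.1.sub hχs.1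
  have hψ0 : ∀ᶠ ξ in 𝓝 (0 : Euc n), ψ ξ = 0 := by
    filter_upwards [ball_mem_nhds (0 : Euc n) one_pos] with ξ hξ
    have h1 : ‖ξ‖ < 1 := by simpa using hξ
    have h2 : χ ξ = 1 := χ.one_of_mem_closedBall (by simpa using h1.le)
    have h3 : χ ((2 : ℝ)⁻¹ • ξ) = 1 := χ.one_of_mem_closedBall (by
      simp only [mem_closedBall, dist_zero_right, norm_smul, norm_inv, Real.norm_ofNat]
      change _ ≤ (1 : ℝ)
      linarith [norm_nonneg ξ])
    simp [ψ, h2, h3]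
  let m : Euc n → V := fun ξ => ψ ξ • b ξ
  have hm : IsTestFun n m := by
    refine ⟨contDiff_iff_contDiffAt.2 fun ξ => ?_, (hχ2.2.sub hχs.2).smul_right⟩
    rcases eq_or_ne ξ 0 with rfl | hξ
    · refine contDiffAt_const (c := (0 : V)) |>.congr_of_eventuallyEq ?_
      filter_upwards [hψ0] with ξ hξ
      simp [m, hξ]
    · exact hψc.contDiffAt.smul (hbc ξ hξ)
  let mhigh : ℕ → Euc n → V := fun j ξ => (((2 : ℝ) ^ j) ^ k)⁻¹ • m (((2 : ℝ) ^ j)⁻¹ • ξ)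
  let χs : ℕ → Euc n → ℝ := fun j ξ => χ (((2 : ℝ) ^ j)⁻¹ • ξ)
  have hhigh : ∀ j, ∀ᵐ ξ : Euc n,
      symbolMap n k A ξ (mhigh j ξ) = (χs (j + 1) ξ - χs j ξ) • w := by
    intro j
    filter_upwards [hae] with ξ hξ
    have h2 : ((2 : ℝ) ^ j) ≠ 0 := by positivity
    set η := ((2 : ℝ) ^ j)⁻¹ • ξ with hη
    have h3 : ξ = (2 : ℝ) ^ j • η := by rw [hη, smul_smul, mul_inv_cancel₀ h2, one_smul]
    have hη0 : η ≠ 0 := by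
      rintro h
      exact hξ (by rw [h3, h, smul_zero])
    have h4 : χs (j + 1) ξ = χ ((2 : ℝ)⁻¹ • η) := by
      simp only [χs, hη, smul_smul, pow_succ, mul_inv]
      rw [mul_comm]
    have h5 : symbolMap n k A ξ = ((2 : ℝ) ^ j) ^ k • symbolMap n k A η := by
      conv_lhs => rw [h3, symbolMap_smul]
    rw [h4, h5]
    simp only [mhigh, m, LinearMap.smul_apply, map_smul, ← hη, hb η hη0, ψ, χs]
    rw [smul_smul, smul_smul, mul_right_comm, inv_mul_cancel₀ (by positivity), one_mul]
  have hmhigh : ∀ j, IsTestFun n (mhigh j) := fun j =>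
    ⟨(hm.1.comp (contDiff_const_smul _)).const_smul _,
      (hm.2.comp_smul (by positivity)).smul_left⟩
  have hhighB : ∀ j (x ξ : Euc n), ‖boundedPhase k ⟪x, ξ⟫ • mhigh j ξ‖ ≤
      (1 + ‖x‖) ^ 0 * ‖mhigh j ξ‖ := by
    intro j x ξ
    rw [norm_smul, pow_zero]
    exact mul_le_mul_of_nonneg_right (abs_boundedPhase_le _ _) (norm_nonneg _)
  have hU : ∀ j, Integrable (planeWaves (boundedPhase k) (mhigh j)) :=
    fun j => integrable_planeWaves_boundedPhase (hmhigh j) k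
  have hUs : Summable fun j => ∫ x, ‖planeWaves (boundedPhase k) (mhigh j) x‖ := by
    have h1 : ∀ j, ∫ x, ‖planeWaves (boundedPhase k) (mhigh j) x‖ =
        (((2 : ℝ) ^ k)⁻¹) ^ j * ∫ x, ‖planeWaves (boundedPhase k) m x‖ := by
      intro j
      have h2 : ∀ x, planeWaves (boundedPhase k) (mhigh j) x = (((2 : ℝ) ^ j) ^ k)⁻¹ •
          planeWaves (boundedPhase k) (fun ξ => m (((2 : ℝ) ^ j)⁻¹ • ξ)) x := by
        intro x
        simp only [planeWaves, mhigh, ← integral_smul]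
        exact integral_congr_ae (Eventually.of_forall fun ξ => smul_comm _ _ _)
      simp only [h2, norm_smul]
      rw [integral_const_mul,
        integral_norm_planeWaves_comp_inv_smul _ _ (by positivity : (0 : ℝ) < 2 ^ j),
        Real.norm_of_nonneg (by positivity), inv_pow, ← pow_mul, ← pow_mul, mul_comm j]
    simp only [h1]
    refine (summable_geometric_of_lt_one (by positivity) ?_).mul_right _
    exact inv_lt_one_of_one_lt₀ (one_lt_pow₀ one_lt_two (by omega))
  obtain ⟨u, hu, hsum⟩ := exists_integrable_hasSum_integral_inner hU hUs
  have hv := locallyIntegrable_planeWaves (isPhase_vanishingPhase.continuous k) hlowm hlowB hlow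
  refine ⟨planeWaves (vanishingPhase k) mlow + u, hv.add hu.locallyIntegrable, fun φ hφ => ?_⟩
  rw [sum_integral_inner_adjoint A (hv.add hu.locallyIntegrable) hφ]
  have hgc := continuous_adjointApply A hφ
  have hgs := hasCompactSupport_adjointApply A hφ
  simp only [Pi.add_apply, inner_add_left]
  rw [integral_add (integrable_inner_of_hasCompactSupport hv hgc hgs)
    (integrable_inner_of_hasCompactSupport hu.locallyIntegrable hgc hgs), mul_add,
    isPhase_vanishingPhase.integral_planeWaves A hlowm hlowB hlow hlowχ hφ]
  have hct := integrable_cosTransform hφ w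
  have hχb : ∀ j ξ, ‖χs j ξ‖ ≤ 1 := fun j ξ => by
    rw [Real.norm_of_nonneg χ.nonneg]
    exact χ.le_one
  have hχc : ∀ j, Continuous (χs j) := fun j => χ.continuous.comp (continuous_const_smul _)
  have hχct : ∀ j, Integrable fun ξ => χs j ξ * cosTransform w φ ξ := fun j =>
    hct.bdd_mul (hχc j).aestronglyMeasurable (Eventually.of_forall (hχb j))
  have hsum1 := (hsum _ hgc hgs).mul_left ((-1) ^ k)
  have hterm : ∀ j, (-1) ^ k *
      ∫ x, ⟪planeWaves (boundedPhase k) (mhigh j) x, adjointApply n k A φ x⟫ =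
      (∫ ξ, χs (j + 1) ξ * cosTransform w φ ξ) - ∫ ξ, χs j ξ * cosTransform w φ ξ := by
    intro j
    rw [isPhase_boundedPhase.integral_planeWaves A
      (hmhigh j).1.continuous.aestronglyMeasurable (hmhigh j).integrable.norm (hhighB j)
      (hhigh j) hφ, ← integral_sub (hχct _) (hχct _)]
    simp only [sub_mul]
  simp only [hterm] at hsum1
  have hlim : Tendsto (fun j => ∫ ξ, χs j ξ * cosTransform w φ ξ) atTop
      (𝓝 (∫ ξ, cosTransform w φ ξ)) := by
    refine tendsto_integral_of_dominated_convergence (fun ξ => ‖cosTransform w φ ξ‖)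
      (fun j => (hχct j).1) hct.norm (fun j => Eventually.of_forall fun ξ => ?_)
      (Eventually.of_forall fun ξ => ?_)
    · rw [norm_mul]
      exact mul_le_of_le_one_left (norm_nonneg _) (hχb j ξ)
    · have h1 : Tendsto (fun j : ℕ => ((2 : ℝ) ^ j)⁻¹ • ξ) atTop (𝓝 ((0 : ℝ) • ξ)) :=
        (tendsto_inv_atTop_zero.comp
          (tendsto_pow_atTop_atTop_of_one_lt one_lt_two)).smul_const ξ
      have h2 := ((χ.continuous.tendsto _).comp h1).mul_const (cosTransform w φ ξ)
      have h3 : χ ((0 : ℝ) • ξ) = 1 := by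
        rw [zero_smul]
        exact χ.one_of_mem_closedBall (by simpa using χ.rIn_pos.le)
      rwa [h3, one_mul] at h2
  have hlim2 := hsum1.tendsto_sum_nat
  simp only [Finset.sum_range_sub (fun j => ∫ ξ, χs j ξ * cosTransform w φ ξ)] at hlim2
  rw [tendsto_nhds_unique hlim2 (hlim.sub_const _), integral_cosTransform hφ w]
  simp [χs]

end Sufficiency

/-- for an elliptic operator `𝒜`,
`⋂_{ξ ∈ 𝕊^{n-1}} im 𝒜[ξ] = {w ∈ W : 𝒜 u = δ₀ w for some u ∈ BV^𝒜_loc}`. -/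
theorem statement13 (n k : ℕ) (hn : 1 ≤ n) (hk : 1 ≤ k) {V W : Type*}
    [NormedAddCommGroup V] [InnerProductSpace ℝ V] [FiniteDimensional ℝ V]
    [NormedAddCommGroup W] [InnerProductSpace ℝ W] [FiniteDimensional ℝ W]
    (A : CoeffOp n k V W) (hA : IsSymmetricOp n k A) (hell : IsElliptic n k A) :
    {w : W | ∀ ξ ∈ sphere (0 : Euc n) 1, w ∈ LinearMap.range (symbolMap n k A ξ)} =
      {w : W | ∃ u : Euc n → V, LocallyIntegrable u volume ∧ HasDistribADirac n k A u w} := by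
  ext w
  refine ⟨fun hw => exists_hasDistribADirac hn hk hell fun ξ hξ => ?_,
    fun ⟨u, hu, huw⟩ ξ hξ => mem_range_symbolMap_of_hasDistribADirac hell hu huw ?_⟩
  · have hn0 : ‖ξ‖ ≠ 0 := norm_ne_zero_iff.2 hξ
    obtain ⟨v, hv⟩ := hw (‖ξ‖⁻¹ • ξ) (by simp [norm_smul, hn0])
    refine ⟨(‖ξ‖⁻¹) ^ k • v, ?_⟩
    rw [← hv, symbolMap_smul, map_smul, LinearMap.smul_apply]
  · rintro rfl
    simp at hξ
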